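/- Let G and H be games over a poset A, both having parity. If G ◁_c H (i.e., o_R(G+X) ≤ o_L(H+X) for every context X), then G and H have mismatching parity. If G ≤_c H (the contextual order), then G and H have matching parity. -/

import Mathlib

/-- Games over a poset `α`: atomic games `[a]` for `a : α`, and composite games
`⟨L|R⟩` given by nonempty families of left and right options. -/
inductive Game (α : Type) : Type 1 where
  | atom : α → Game α
  | comp : (ι κ : Type) → (ι → Game α) → (κ → Game α) → Nonempty ι → Nonempty κ → Game α

namespace Game

variable {α β : Type}

/-- `G'` is a left option of the game. -/
def IsLeftOption (G' : Game α) : Game α → Prop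
  | atom _ => False
  | comp _ _ L _ _ _ => ∃ i, L i = G'

/-- `G'` is a right option of the game. -/
def IsRightOption (G' : Game α) : Game α → Prop
  | atom _ => False
  | comp _ _ _ R _ _ => ∃ k, R k = G'

/-- `G'` is an option of `G`. -/
def IsOption (G' G : Game α) : Prop := IsLeftOption G' G ∨ IsRightOption G' G

/-- A game is composite if it is not atomic. -/
def IsComposite : Game α → Prop
  | atom _ => False
  | comp _ _ _ _ _ _ => True

/-- `G'` is a follower of `G`: `G` itself, an option of `G`, or recursively a follower
of an option of `G`. -/
def IsFollower (G' G : Game α) : Prop := Relation.ReflTransGen IsOption G' G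

/-- The dual game: Left and Right switch sides; it is a game over the opposite poset. -/
def dual : Game α → Game αᵒᵈ
  | atom a => atom (OrderDual.toDual a)
  | comp ι κ L R hι hκ => comp κ ι (fun k => (R k).dual) (fun i => (L i).dual) hκ hι

/-- The image of a game under a (monotone) function applied to atoms. -/
def map (f : α → β) : Game α → Game β
  | atom a => atom (f a)
  | comp ι κ L R hι hκ => comp ι κ (fun i => (L i).map f) (fun k => (R k).map f) hι hκ

/-- The (disjunctive) sum of a game over `α` and a game over `β`, a game over `α × β`. -/
noncomputable def add : Game α → Game β → Game (α × β) := by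
  intro G
  induction G with
  | atom g =>
    intro H
    induction H with
    | atom h => exact atom (g, h)
    | comp ι κ L R hι hκ IHL IHR => exact comp ι κ IHL IHR hι hκ
  | comp ι κ L R hι hκ IHL IHR =>
    intro H
    induction H with
    | atom h => exact comp ι κ (fun i => IHL i (atom h)) (fun k => IHR k (atom h)) hι hκ
    | comp ι' κ' L' R' hι' hκ' IHL' IHR' =>
      exact comp (ι ⊕ ι') (κ ⊕ κ')
        (Sum.elim (fun i => IHL i (comp ι' κ' L' R' hι' hκ')) IHL')
        (Sum.elim (fun k => IHR k (comp ι' κ' L' R' hι' hκ')) IHR')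
        (hι.elim fun i => ⟨Sum.inl i⟩) (hκ.elim fun k => ⟨Sum.inl k⟩)

mutual
/-- Left has a first player winning strategy in a game over the boolean poset:
either the game is the atom `⊤`, or some left option has a second player
winning strategy for Left. -/
inductive LeftWinsFirst : Game Bool → Prop where
  | atom_top : LeftWinsFirst (atom true)
  | move {G G' : Game Bool} : IsLeftOption G' G → LeftWinsSecond G' → LeftWinsFirst G

/-- Left has a second player winning strategy in a game over the boolean poset:
every right option has a first player winning strategy for Left, and if the game
is atomic it is the atom `⊤`. -/
inductive LeftWinsSecond : Game Bool → Prop where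
  | mk {G : Game Bool} : (∀ G', IsRightOption G' G → LeftWinsFirst G') →
      (∀ b, G = atom b → b = true) → LeftWinsSecond G
end

mutual
/-- A game is even if all of its options are odd (atomic games are even). -/
inductive Even {α : Type} : Game α → Prop where
  | mk {G : Game α} : (∀ G', IsOption G' G → Odd G') → Even G

/-- A game is odd if it is composite and all of its options are even. -/
inductive Odd {α : Type} : Game α → Prop where
  | mk {G : Game α} : G.IsComposite → (∀ G', IsOption G' G → Even G') → Odd G
end

/-- A game has parity if it is even or odd. -/
def HasParity (G : Game α) : Prop := Even G ∨ Odd G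

/-- `G` and `H` have matching parity (both even or both odd). -/
def MatchingParity (G H : Game α) : Prop := (Even G ∧ Even H) ∨ (Odd G ∧ Odd H)

/-- `G` and `H` have mismatching parity (one even, the other odd). -/
def MismatchParity (G H : Game α) : Prop := (Even G ∧ Odd H) ∨ (Odd G ∧ Even H)

mutual
/-- The intrinsic order `G ≤ H` on games over a poset: every left option `G^L` of `G`
satisfies `G^L ◁ H`, every right option `H^R` of `H` satisfies `G ◁ H^R`, and if
both games are atoms `[g]`, `[h]` then `g ≤ h`. -/
inductive Le {α : Type} [PartialOrder α] : Game α → Game α → Prop where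
  | mk {G H : Game α} :
      (∀ G', IsLeftOption G' G → Tri G' H) →
      (∀ H', IsRightOption H' H → Tri G H') →
      (∀ g h, G = atom g → H = atom h → g ≤ h) →
      Le G H

/-- The intrinsic relation `G ◁ H` on games over a poset: some right option `G^R` of `G`
satisfies `G^R ≤ H`, or some left option `H^L` of `H` satisfies `G ≤ H^L`. -/
inductive Tri {α : Type} [PartialOrder α] : Game α → Game α → Prop where
  | inr {G H G' : Game α} : IsRightOption G' G → Le G' H → Tri G H
  | inl {G H H' : Game α} : IsLeftOption H' H → Le G H' → Tri G H
end

/-- The comparison game `λ(Gᵒᵖ + H)`, a game over the boolean poset, where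
`λ : αᵒᵈ × α → 𝔹` is the monotone map with `λ(xᵒᵖ, y) = ⊤` iff `x ≤ y`. -/
noncomputable def comparison [PartialOrder α] (G H : Game α) : Game Bool :=
  map (fun p : αᵒᵈ × α => @decide (OrderDual.ofDual p.1 ≤ p.2) (Classical.propDecidable _))
    (G.dual.add H)

/-- A game is locally premotive if Left has a first player winning strategy in
the comparison game `λ(Gᵒᵖ + G)`. -/
def LocallyPremotive [PartialOrder α] (G : Game α) : Prop := LeftWinsFirst (comparison G G)

/-- A game is premotive if it and all of its followers are locally premotive. -/
def Premotive [PartialOrder α] (G : Game α) : Prop :=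
  ∀ G', IsFollower G' G → LocallyPremotive G'

/-- The game `* = ⟨0|0⟩` over the one-element poset. -/
def star : Game Unit := comp Unit Unit (fun _ => atom ()) (fun _ => atom ()) ⟨()⟩ ⟨()⟩

/-- `G + *`, identified with a game over `α` via the isomorphism `α × 1 ≅ α`. -/
noncomputable def addStar (G : Game α) : Game α := map Prod.fst (G.add star)

/-- A game is locally `*`-antimonotone if `G^L + * ≤ G ≤ G^R + *` for all left and
right options `G^L`, `G^R`. -/
def LocallyStarAnti [PartialOrder α] (G : Game α) : Prop :=
  (∀ G', IsLeftOption G' G → Le G'.addStar G) ∧ (∀ G', IsRightOption G' G → Le G G'.addStar)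

/-- A game is `*`-antimonotone if it and all of its followers are locally
`*`-antimonotone. -/
def StarAnti [PartialOrder α] (G : Game α) : Prop :=
  ∀ G', IsFollower G' G → LocallyStarAnti G'

/-- `ε(G + X)`: the game `G` over `α` embedded in a context `X`, a game over the poset
`[α, 𝔹]` of monotone functions `α → 𝔹`, via the application map `ε(a, f) = f a`. -/
noncomputable def ctxSum [PartialOrder α] (G : Game α) (X : Game (α →o Bool)) : Game Bool :=
  map (fun p : α × (α →o Bool) => p.2 p.1) (G.add X)

/-- The outcome `(o_L(G), o_R(G)) ∈ 𝔹 × 𝔹` of a game over the boolean poset: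
`o_L(G) = ⊤` iff Left has a first player winning strategy and `o_R(G) = ⊤` iff
Left has a second player winning strategy. -/
noncomputable def outcome (G : Game Bool) : Bool × Bool :=
  (@decide (LeftWinsFirst G) (Classical.propDecidable _),
   @decide (LeftWinsSecond G) (Classical.propDecidable _))

/-- The contextual order `G ≤_c H`: `o(G+X) ≤ o(H+X)` for every context `X`. -/
def ContextualLe [PartialOrder α] (G H : Game α) : Prop :=
  ∀ X : Game (α →o Bool), outcome (ctxSum G X) ≤ outcome (ctxSum H X)

/-- The contextual relation `G ◁_c H`: `o_R(G+X) ≤ o_L(H+X)` for every context `X`. -/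
def ContextualTri [PartialOrder α] (G H : Game α) : Prop :=
  ∀ X : Game (α →o Bool), (outcome (ctxSum G X)).2 ≤ (outcome (ctxSum H X)).1

/-- Two games are identical when they are equal as set-based games: both are the same
atom, or both are composite with identical sets of left options and identical sets of
right options (recursively). -/
def Identical : Game α → Game α → Prop
  | atom a, atom b => a = b
  | comp _ _ L R _ _, comp _ _ L' R' _ _ =>
      ((∀ i, ∃ i', Identical (L i) (L' i')) ∧ (∀ i', ∃ i, Identical (L i) (L' i'))) ∧
      ((∀ k, ∃ k', Identical (R k) (R' k')) ∧ (∀ k', ∃ k, Identical (R k) (R' k')))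
  | _, _ => False

theorem first_comp {ι κ : Type} {L : ι → Game Bool} {R : κ → Game Bool} {hι hκ} :
    LeftWinsFirst (comp ι κ L R hι hκ) ↔ ∃ i, LeftWinsSecond (L i) := by
  constructor
  · intro h
    cases h with
    | move h1 h2 =>
      obtain ⟨i, rfl⟩ := h1
      exact ⟨i, h2⟩
  · rintro ⟨i, hi⟩
    exact LeftWinsFirst.move (G' := L i) ⟨i, rfl⟩ hi

theorem second_comp {ι κ : Type} {L : ι → Game Bool} {R : κ → Game Bool} {hι hκ} :
    LeftWinsSecond (comp ι κ L R hι hκ) ↔ ∀ k, LeftWinsFirst (R k) := by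
  constructor
  · intro h k
    cases h with
    | mk h1 h2 => exact h1 _ ⟨k, rfl⟩
  · intro h
    refine LeftWinsSecond.mk ?_ ?_
    · rintro G' ⟨k, rfl⟩
      exact h k
    · intro b hb
      cases hb

theorem first_atom {b : Bool} : LeftWinsFirst (atom b) ↔ b = true := by
  constructor
  · intro h
    cases h with
    | atom_top => rfl
    | move h1 h2 => exact h1.elim
  · rintro rfl
    exact LeftWinsFirst.atom_top

theorem second_atom {b : Bool} : LeftWinsSecond (atom b) ↔ b = true := by
  constructor
  · intro h
    cases h with
    | mk h1 h2 => exact h2 b rfl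
  · rintro rfl
    refine LeftWinsSecond.mk (fun G' h => h.elim) ?_
    intro b hb
    cases hb
    rfl

section Ctx

variable [PartialOrder α] {ι κ ι' κ' : Type} {hι : Nonempty ι} {hκ : Nonempty κ}
  {hι' : Nonempty ι'} {hκ' : Nonempty κ'}
  {L : ι → Game α} {R : κ → Game α} {L' : ι' → Game (α →o Bool)} {R' : κ' → Game (α →o Bool)}

theorem first_cc :
    LeftWinsFirst (ctxSum (comp ι κ L R hι hκ) (comp ι' κ' L' R' hι' hκ')) ↔
      (∃ i, LeftWinsSecond (ctxSum (L i) (comp ι' κ' L' R' hι' hκ'))) ∨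
      ∃ i, LeftWinsSecond (ctxSum (comp ι κ L R hι hκ) (L' i)) :=
  (first_comp (L := fun s => map _ (Sum.elim _ _ s))).trans Sum.exists

theorem second_cc :
    LeftWinsSecond (ctxSum (comp ι κ L R hι hκ) (comp ι' κ' L' R' hι' hκ')) ↔
      (∀ i, LeftWinsFirst (ctxSum (R i) (comp ι' κ' L' R' hι' hκ'))) ∧
      ∀ i, LeftWinsFirst (ctxSum (comp ι κ L R hι hκ) (R' i)) :=
  (second_comp (R := fun s => map _ (Sum.elim _ _ s))).trans Sum.forall

theorem first_ac {a : α} :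
    LeftWinsFirst (ctxSum (atom a) (comp ι' κ' L' R' hι' hκ')) ↔
      ∃ i, LeftWinsSecond (ctxSum (atom a) (L' i)) := first_comp

theorem second_ac {a : α} :
    LeftWinsSecond (ctxSum (atom a) (comp ι' κ' L' R' hι' hκ')) ↔
      ∀ i, LeftWinsFirst (ctxSum (atom a) (R' i)) := second_comp

theorem wins_const (b : Bool) (G : Game α) :
    (LeftWinsFirst (ctxSum G (atom (OrderHom.const α b))) ↔ b = true) ∧
    (LeftWinsSecond (ctxSum G (atom (OrderHom.const α b))) ↔ b = true) := by
  induction G with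
  | atom a => exact ⟨first_atom, second_atom⟩
  | comp ι κ L R hι hκ IHL IHR =>
    constructor
    · refine first_comp.trans ((exists_congr fun i => (IHL i).2).trans ?_)
      simp
    · refine second_comp.trans ((forall_congr' fun i => (IHR i).1).trans ?_)
      simp

/-- The context `⟨⊥|⊤⟩`: whoever moves in it loses. -/
def zug (α : Type) [PartialOrder α] : Game (α →o Bool) :=
  comp Unit Unit (fun _ => atom (OrderHom.const α false)) (fun _ => atom (OrderHom.const α true))
    ⟨()⟩ ⟨()⟩

/-- The context with `zug` as its only left and right option. -/
def zug' (α : Type) [PartialOrder α] : Game (α →o Bool) :=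
  comp Unit Unit (fun _ => zug α) (fun _ => zug α) ⟨()⟩ ⟨()⟩

/-- The first player wins. -/
def FW (K : Game Bool) : Prop := LeftWinsFirst K ∧ ¬ LeftWinsSecond K

/-- The second player wins. -/
def SW (K : Game Bool) : Prop := ¬ LeftWinsFirst K ∧ LeftWinsSecond K

theorem Even.left (h : Even (comp ι κ L R hι hκ)) (i : ι) : Odd (L i) := by
  cases h with
  | mk h => exact h _ (Or.inl ⟨i, rfl⟩)

theorem Even.right (h : Even (comp ι κ L R hι hκ)) (i : κ) : Odd (R i) := by
  cases h with
  | mk h => exact h _ (Or.inr ⟨i, rfl⟩)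

theorem Odd.left (h : Odd (comp ι κ L R hι hκ)) (i : ι) : Even (L i) := by
  cases h with
  | mk _ h => exact h _ (Or.inl ⟨i, rfl⟩)

theorem Odd.right (h : Odd (comp ι κ L R hι hκ)) (i : κ) : Even (R i) := by
  cases h with
  | mk _ h => exact h _ (Or.inr ⟨i, rfl⟩)

theorem not_odd_atom {a : α} : ¬ Odd (atom a) := by
  intro h
  cases h with
  | mk h _ => exact h

theorem zug_wins (G : Game α) :
    (Even G → SW (ctxSum G (zug α))) ∧ (Odd G → FW (ctxSum G (zug α))) := by
  induction G with
  | atom a =>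
    refine ⟨fun _ => ⟨?_, ?_⟩, fun h => (not_odd_atom h).elim⟩
    · rw [zug, first_ac]
      simp [wins_const]
    · rw [zug, second_ac]
      simp [wins_const]
  | comp ι κ L R hι hκ IHL IHR =>
    refine ⟨fun h => ⟨?_, ?_⟩, fun h => ⟨?_, ?_⟩⟩
    · rw [zug, first_cc]
      simp only [wins_const]
      rintro (⟨i, hi⟩ | ⟨_, hi⟩)
      · exact ((IHL i).2 (h.left i)).2 hi
      · cases hi
    · rw [zug, second_cc]
      simp only [wins_const]
      exact ⟨fun i => ((IHR i).2 (h.right i)).1, fun _ => trivial⟩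
    · rw [zug, first_cc]
      obtain ⟨i⟩ := hι
      exact Or.inl ⟨i, ((IHL i).1 (h.left i)).2⟩
    · rw [zug, second_cc]
      obtain ⟨i⟩ := hκ
      exact fun hh => ((IHR i).1 (h.right i)).1 (hh.1 i)

theorem zug'_even (G : Game α) (h : Even G) : FW (ctxSum G (zug' α)) := by
  have hz := (zug_wins G).1 h
  cases G with
  | atom a =>
    refine ⟨?_, ?_⟩
    · rw [zug', first_ac]
      exact ⟨(), hz.2⟩
    · rw [zug', second_ac]
      exact fun hh => hz.1 (hh ())
  | comp ι κ L R hι hκ =>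
    refine ⟨?_, ?_⟩
    · rw [zug', first_cc]
      exact Or.inr ⟨(), hz.2⟩
    · rw [zug', second_cc]
      exact fun hh => hz.1 (hh.2 ())

theorem zug'_odd (G : Game α) (h : Odd G) : SW (ctxSum G (zug' α)) := by
  have hz := (zug_wins G).2 h
  cases G with
  | atom a => exact (not_odd_atom h).elim
  | comp ι κ L R hι hκ =>
    refine ⟨?_, ?_⟩
    · rw [zug', first_cc]
      rintro (⟨i, hi⟩ | ⟨_, hi⟩)
      · exact (zug'_even _ (h.left i)).2 hi
      · exact hz.2 hi
    · rw [zug', second_cc]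
      exact ⟨fun i => (zug'_even _ (h.right i)).1, fun _ => hz.1⟩

theorem tri_apply {G H : Game α} (h : ContextualTri G H) (X : Game (α →o Bool))
    (hX : LeftWinsSecond (ctxSum G X)) : LeftWinsFirst (ctxSum H X) := by
  have := h X
  simp only [outcome, Bool.le_iff_imp, decide_eq_true_eq] at this
  exact this hX

theorem le_apply {G H : Game α} (h : ContextualLe G H) (X : Game (α →o Bool)) :
    (LeftWinsFirst (ctxSum G X) → LeftWinsFirst (ctxSum H X)) ∧
    (LeftWinsSecond (ctxSum G X) → LeftWinsSecond (ctxSum H X)) := by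
  have := h X
  simp only [outcome, Prod.mk_le_mk, Bool.le_iff_imp, decide_eq_true_eq] at this
  exact this

end Ctx

/-- For games with parity, `G ◁_c H` forces mismatching parity and
`G ≤_c H` forces matching parity. -/
theorem contextual_parity {α : Type} [PartialOrder α] (G H : Game α)
    (hG : HasParity G) (hH : HasParity H) :
    (ContextualTri G H → MismatchParity G H) ∧
    (ContextualLe G H → MatchingParity G H) := by
  constructor
  · intro h
    rcases hG with hG | hG <;> rcases hH with hH | hH
    · exact (((zug_wins H).1 hH).1 (tri_apply h _ ((zug_wins G).1 hG).2)).elim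
    · exact Or.inl ⟨hG, hH⟩
    · exact Or.inr ⟨hG, hH⟩
    · exact ((zug'_odd H hH).1 (tri_apply h _ (zug'_odd G hG).2)).elim
  · intro h
    rcases hG with hG | hG <;> rcases hH with hH | hH
    · exact Or.inl ⟨hG, hH⟩
    · exact (((zug_wins H).2 hH).2 ((le_apply h _).2 ((zug_wins G).1 hG).2)).elim
    · exact (((zug_wins H).1 hH).1 ((le_apply h _).1 ((zug_wins G).2 hG).1)).elim
    · exact Or.inr ⟨hG, hH⟩

end Game
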